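/- Let K be a field, R' = K[X]/(X³), and let S be a non-Noetherian hereditary commutative ring. Then the product ring R' × S is Gorenstein hereditary but not strongly Gorenstein hereditary. -/

import Mathlib

noncomputable section

universe u

variable (R : Type u) [CommRing R]

/-- `IsShortExact R f g` says that `0 → A → B → C → 0` is a short exact sequence. -/
def IsShortExact {A B C : Type u} [AddCommGroup A] [Module R A] [AddCommGroup B] [Module R B]
    [AddCommGroup C] [Module R C] (f : A →ₗ[R] B) (g : B →ₗ[R] C) : Prop :=
  Function.Injective f ∧ Function.Surjective g ∧ LinearMap.range f = LinearMap.ker g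

/-- A module `M` is Gorenstein projective if there is a complete projective resolution
`⋯ → P i → P (i+1) → ⋯` (an exact sequence of projective modules which remains exact after
applying `Hom(-, Q)` for every projective module `Q`) with `M ≅ Im (P 0 → P 1)`. -/
def IsGorensteinProjective (M : Type u) [AddCommGroup M] [Module R M] : Prop :=
  ∃ (P : ℤ → Type u) (_ : ∀ i, AddCommGroup (P i)) (_ : ∀ i, Module R (P i))
    (d : ∀ i, P i →ₗ[R] P (i + 1)),
    (∀ i, Module.Projective R (P i)) ∧
    (∀ i, LinearMap.range (d i) = LinearMap.ker (d (i + 1))) ∧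
    Nonempty (M ≃ₗ[R] LinearMap.range (d 0)) ∧
    (∀ (Q : Type u) (_ : AddCommGroup Q) (_ : Module R Q), Module.Projective R Q →
      ∀ (i : ℤ) (g : P (i + 1) →ₗ[R] Q), g.comp (d i) = 0 →
        ∃ h : P (i + 1 + 1) →ₗ[R] Q, h.comp (d (i + 1)) = g)

/-- A module `M` is strongly Gorenstein projective if there is a complete projective
resolution of the form `⋯ → P →f P →f P → ⋯` with `M ≅ Im f`. -/
def IsStronglyGorensteinProjective (M : Type u) [AddCommGroup M] [Module R M] : Prop :=
  ∃ (P : Type u) (_ : AddCommGroup P) (_ : Module R P) (f : P →ₗ[R] P),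
    Module.Projective R P ∧
    LinearMap.range f = LinearMap.ker f ∧
    Nonempty (M ≃ₗ[R] LinearMap.range f) ∧
    (∀ (Q : Type u) (_ : AddCommGroup Q) (_ : Module R Q), Module.Projective R Q →
      ∀ g : P →ₗ[R] Q, g.comp f = 0 → ∃ h : P →ₗ[R] Q, h.comp f = g)

/-- A module `M` is Gorenstein flat if there is an exact sequence of flat modules
`⋯ → F i → F (i+1) → ⋯` which remains exact after applying `- ⊗ I` for every injective
module `I`, with `M ≅ Im (F 0 → F 1)`. -/
def IsGorensteinFlat (M : Type u) [AddCommGroup M] [Module R M] : Prop :=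
  ∃ (F : ℤ → Type u) (_ : ∀ i, AddCommGroup (F i)) (_ : ∀ i, Module R (F i))
    (d : ∀ i, F i →ₗ[R] F (i + 1)),
    (∀ i, Module.Flat R (F i)) ∧
    (∀ i, LinearMap.range (d i) = LinearMap.ker (d (i + 1))) ∧
    Nonempty (M ≃ₗ[R] LinearMap.range (d 0)) ∧
    (∀ (I : Type u) (_ : AddCommGroup I) (_ : Module R I), Module.Injective R I →
      ∀ i : ℤ, LinearMap.range (LinearMap.rTensor I (d i)) =
        LinearMap.ker (LinearMap.rTensor I (d (i + 1))))

/-- A module `M` is strongly Gorenstein flat if there is an exact sequence of flat modules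
of the form `⋯ → F →f F →f F → ⋯` which remains exact after applying `- ⊗ I` for every
injective module `I`, with `M ≅ Im f`. -/
def IsStronglyGorensteinFlat (M : Type u) [AddCommGroup M] [Module R M] : Prop :=
  ∃ (F : Type u) (_ : AddCommGroup F) (_ : Module R F) (f : F →ₗ[R] F),
    Module.Flat R F ∧
    LinearMap.range f = LinearMap.ker f ∧
    Nonempty (M ≃ₗ[R] LinearMap.range f) ∧
    (∀ (I : Type u) (_ : AddCommGroup I) (_ : Module R I), Module.Injective R I →
      LinearMap.range (LinearMap.rTensor I f) = LinearMap.ker (LinearMap.rTensor I f))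

/-- `ProjDimLE R M n` : the projective dimension of `M` is at most `n`, i.e. there is an exact
sequence `0 → P n → ⋯ → P 0 → M → 0` with each `P i` projective. -/
def ProjDimLE (M : Type u) [AddCommGroup M] [Module R M] (n : ℕ) : Prop :=
  ∃ (P : ℕ → Type u) (_ : ∀ i, AddCommGroup (P i)) (_ : ∀ i, Module R (P i))
    (d : ∀ i, P (i + 1) →ₗ[R] P i) (ε : P 0 →ₗ[R] M),
    (∀ i, Module.Projective R (P i)) ∧
    (∀ i, n < i → Subsingleton (P i)) ∧
    Function.Surjective ε ∧
    LinearMap.ker ε = LinearMap.range (d 0) ∧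
    (∀ i, LinearMap.ker (d i) = LinearMap.range (d (i + 1)))

/-- `InjDimLE R M n` : the injective dimension of `M` is at most `n`, i.e. there is an exact
sequence `0 → M → E 0 → ⋯ → E n → 0` with each `E i` injective. -/
def InjDimLE (M : Type u) [AddCommGroup M] [Module R M] (n : ℕ) : Prop :=
  ∃ (E : ℕ → Type u) (_ : ∀ i, AddCommGroup (E i)) (_ : ∀ i, Module R (E i))
    (d : ∀ i, E i →ₗ[R] E (i + 1)) (η : M →ₗ[R] E 0),
    (∀ i, Module.Injective R (E i)) ∧
    (∀ i, n < i → Subsingleton (E i)) ∧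
    Function.Injective η ∧
    LinearMap.range η = LinearMap.ker (d 0) ∧
    (∀ i, LinearMap.range (d i) = LinearMap.ker (d (i + 1)))

/-- `FlatDimLE R M n` : the flat dimension of `M` is at most `n`. -/
def FlatDimLE (M : Type u) [AddCommGroup M] [Module R M] (n : ℕ) : Prop :=
  ∃ (F : ℕ → Type u) (_ : ∀ i, AddCommGroup (F i)) (_ : ∀ i, Module R (F i))
    (d : ∀ i, F (i + 1) →ₗ[R] F i) (ε : F 0 →ₗ[R] M),
    (∀ i, Module.Flat R (F i)) ∧
    (∀ i, n < i → Subsingleton (F i)) ∧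
    Function.Surjective ε ∧
    LinearMap.ker ε = LinearMap.range (d 0) ∧
    (∀ i, LinearMap.ker (d i) = LinearMap.range (d (i + 1)))

/-- `GProjDimLE R M n` : the Gorenstein projective dimension of `M` is at most `n`, i.e.
there is an exact sequence `0 → G n → ⋯ → G 0 → M → 0` with each `G i` Gorenstein
projective. -/
def GProjDimLE (M : Type u) [AddCommGroup M] [Module R M] (n : ℕ) : Prop :=
  ∃ (G : ℕ → Type u) (_ : ∀ i, AddCommGroup (G i)) (_ : ∀ i, Module R (G i))
    (d : ∀ i, G (i + 1) →ₗ[R] G i) (ε : G 0 →ₗ[R] M),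
    (∀ i, IsGorensteinProjective R (G i)) ∧
    (∀ i, n < i → Subsingleton (G i)) ∧
    Function.Surjective ε ∧
    LinearMap.ker ε = LinearMap.range (d 0) ∧
    (∀ i, LinearMap.ker (d i) = LinearMap.range (d (i + 1)))

/-- `GFlatDimLE R M n` : the Gorenstein flat dimension of `M` is at most `n`. -/
def GFlatDimLE (M : Type u) [AddCommGroup M] [Module R M] (n : ℕ) : Prop :=
  ∃ (G : ℕ → Type u) (_ : ∀ i, AddCommGroup (G i)) (_ : ∀ i, Module R (G i))
    (d : ∀ i, G (i + 1) →ₗ[R] G i) (ε : G 0 →ₗ[R] M),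
    (∀ i, IsGorensteinFlat R (G i)) ∧
    (∀ i, n < i → Subsingleton (G i)) ∧
    Function.Surjective ε ∧
    LinearMap.ker ε = LinearMap.range (d 0) ∧
    (∀ i, LinearMap.ker (d i) = LinearMap.range (d (i + 1)))

/-- A module is finitely presented if it is the quotient of a finite free module by a
finitely generated submodule of relations. -/
def IsFinitelyPresented (M : Type u) [AddCommGroup M] [Module R M] : Prop :=
  ∃ (n : ℕ) (f : (Fin n → R) →ₗ[R] M), Function.Surjective f ∧ (LinearMap.ker f).FG

/-- A ring is coherent if every finitely generated ideal is finitely presented. -/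
def IsCoherentRing : Prop :=
  ∀ I : Ideal R, I.FG → IsFinitelyPresented R I

/-- `ExtVanishes R M N i` : `Ext_R^i(M, N) = 0`. -/
def ExtVanishes (M N : Type u) [AddCommGroup M] [Module R M] [AddCommGroup N] [Module R N]
    (i : ℕ) : Prop :=
  Subsingleton (((Ext R (ModuleCat.{u} R) i).obj
    (Opposite.op (ModuleCat.of R M))).obj (ModuleCat.of R N))

/-- A ring is hereditary if every submodule of a projective module is projective. -/
def IsHereditaryRing : Prop :=
  ∀ (P : Type u) (_ : AddCommGroup P) (_ : Module R P), Module.Projective R P →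
    ∀ N : Submodule R P, Module.Projective R N

/-- A ring is semihereditary if every finitely generated ideal is projective. -/
def IsSemihereditaryRing : Prop :=
  ∀ I : Ideal R, I.FG → Module.Projective R I

/-- A ring is Gorenstein hereditary if every submodule of a projective module is
Gorenstein projective. -/
def IsGHereditaryRing : Prop :=
  ∀ (P : Type u) (_ : AddCommGroup P) (_ : Module R P), Module.Projective R P →
    ∀ N : Submodule R P, IsGorensteinProjective R N

/-- A ring is strongly Gorenstein hereditary if every submodule of a projective module is
strongly Gorenstein projective. -/
def IsSGHereditaryRing : Prop :=
  ∀ (P : Type u) (_ : AddCommGroup P) (_ : Module R P), Module.Projective R P →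
    ∀ N : Submodule R P, IsStronglyGorensteinProjective R N

/-- A ring is Gorenstein semihereditary if it is coherent and every submodule of a flat
module is Gorenstein flat. -/
def IsGSemihereditaryRing : Prop :=
  IsCoherentRing R ∧
    ∀ (F : Type u) (_ : AddCommGroup F) (_ : Module R F), Module.Flat R F →
      ∀ N : Submodule R F, IsGorensteinFlat R N

/-- A ring is strongly Gorenstein semihereditary if it is coherent and every submodule of a
flat module is strongly Gorenstein flat. -/
def IsSGSemihereditaryRing : Prop :=
  IsCoherentRing R ∧
    ∀ (F : Type u) (_ : AddCommGroup F) (_ : Module R F), Module.Flat R F →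
      ∀ N : Submodule R F, IsStronglyGorensteinFlat R N

open scoped TensorProduct

theorem Module.Projective.of_isScalarTower (A B M : Type*) [CommRing A] [CommRing B] [Algebra A B]
    [AddCommGroup M] [Module A M] [Module B M] [IsScalarTower A B M] [Module.Projective A B]
    [Module.Projective B M] : Module.Projective A M := by
  obtain ⟨s, hs⟩ := Module.projective_def.mp (inferInstance : Module.Projective B M)
  classical
  have : Module.Projective A (M →₀ B) :=
    Module.Projective.of_equiv' (finsuppLequivDFinsupp (M := B) (ι := M) A).symm
  refine Module.Projective.of_split (M := M →₀ B) (s.restrictScalars A)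
    ((Finsupp.linearCombination B id).restrictScalars A) ?_
  ext m
  exact hs m

section GorensteinProjective

variable {A B : Type u} [CommRing A] [CommRing B]

theorem IsGorensteinProjective.congr {M N : Type u} [AddCommGroup M] [Module A M]
    [AddCommGroup N] [Module A N] (e : M ≃ₗ[A] N) (h : IsGorensteinProjective A M) :
    IsGorensteinProjective A N := by
  obtain ⟨P, _, _, d, hP, hd, ⟨i⟩, hQ⟩ := h
  exact ⟨P, _, _, d, hP, hd, ⟨e.symm.trans i⟩, hQ⟩

theorem IsGorensteinProjective.of_projective (M : Type u) [AddCommGroup M] [Module A M]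
    [Module.Projective A M] : IsGorensteinProjective A M := by
  have hd : LinearMap.range (LinearMap.inr A M M ∘ₗ LinearMap.fst A M M) =
      LinearMap.ker (LinearMap.inr A M M ∘ₗ LinearMap.fst A M M) := by
    ext ⟨a, b⟩
    constructor
    · rintro ⟨c, hc⟩
      have : a = 0 := (congrArg Prod.fst hc).symm
      simp [this, Prod.mk_zero_zero]
    · intro h
      have : a = 0 := congrArg Prod.snd h
      exact ⟨(b, 0), by simp [this]⟩
  refine ⟨fun _ => M × M, fun _ => inferInstance, fun _ => inferInstance,
    fun _ => LinearMap.inr A M M ∘ₗ LinearMap.fst A M M, fun _ => inferInstance, fun _ => hd,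
    ⟨LinearEquiv.ofBijective
      ((LinearMap.inr A M M).codRestrict
        (LinearMap.range (LinearMap.inr A M M ∘ₗ LinearMap.fst A M M)) fun m => ⟨(m, 0), rfl⟩)
        ⟨?_, ?_⟩⟩, ?_⟩
  · intro a b hab
    exact congrArg (fun z => z.1.2) hab
  · rintro ⟨_, ⟨a, b⟩, rfl⟩
    exact ⟨a, rfl⟩
  · intro Q _ _ _ _ g hg
    refine ⟨g ∘ₗ LinearMap.inl A M M ∘ₗ LinearMap.snd A M M, LinearMap.ext fun ⟨a, b⟩ => ?_⟩
    have h := LinearMap.congr_fun hg (b, 0)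
    have hab : ((a, b) : M × M) = (a, 0) + (0, b) := by simp
    rw [hab, map_add, map_add]
    simpa [Prod.mk_zero_zero] using h

theorem IsGorensteinProjective.prod {M N : Type u} [AddCommGroup M] [Module A M]
    [AddCommGroup N] [Module A N] (hM : IsGorensteinProjective A M)
    (hN : IsGorensteinProjective A N) : IsGorensteinProjective A (M × N) := by
  obtain ⟨P, _, _, d, hP, hd, ⟨i⟩, hQ⟩ := hM
  obtain ⟨P', _, _, d', hP', hd', ⟨i'⟩, hQ'⟩ := hN
  refine ⟨fun i => P i × P' i, fun _ => inferInstance, fun _ => inferInstance,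
    fun i => (d i).prodMap (d' i), fun i => ?_, fun i => ?_,
    ⟨(i.prodCongr i').trans (?_ : _ ≃ₗ[A] _)⟩, ?_⟩
  · have := hP i
    have := hP' i
    infer_instance
  · rw [LinearMap.range_prodMap, LinearMap.ker_prodMap, hd, hd']
  · refine LinearEquiv.ofBijective
      (((LinearMap.range (d 0)).subtype.prodMap (LinearMap.range (d' 0)).subtype).codRestrict
        (LinearMap.range ((d 0).prodMap (d' 0))) ?_) ⟨?_, ?_⟩
    · rintro ⟨⟨_, a, rfl⟩, ⟨_, b, rfl⟩⟩
      exact ⟨(a, b), rfl⟩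
    · rintro ⟨⟨a, _⟩, ⟨b, _⟩⟩ ⟨⟨a', _⟩, ⟨b', _⟩⟩ h
      simpa [Subtype.ext_iff] using h
    · rintro ⟨_, ⟨a, b⟩, rfl⟩
      exact ⟨(⟨d 0 a, a, rfl⟩, ⟨d' 0 b, b, rfl⟩), rfl⟩
  · intro Q _ _ hp i g hg
    obtain ⟨h, hh⟩ := hQ Q _ _ hp i (g ∘ₗ LinearMap.inl A _ _) <| LinearMap.ext fun a => by
      simpa using LinearMap.congr_fun hg (a, 0)
    obtain ⟨h', hh'⟩ := hQ' Q _ _ hp i (g ∘ₗ LinearMap.inr A _ _) <| LinearMap.ext fun a => by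
      simpa using LinearMap.congr_fun hg (0, a)
    refine ⟨h.coprod h', LinearMap.prod_ext ?_ ?_⟩
    · rw [← hh]
      ext a
      simp
    · rw [← hh']
      ext a
      simp

/-- Gorenstein projectivity descends along a surjection of rings `A → B` with `B` projective
over `A`, that is, along the projection onto a direct factor. -/
theorem IsGorensteinProjective.of_surjective [Algebra A B] [Module.Projective A B]
    (hAB : Function.Surjective (algebraMap A B)) {M : Type u} [AddCommGroup M] [Module A M]
    [Module B M] [IsScalarTower A B M] (h : IsGorensteinProjective B M) :
    IsGorensteinProjective A M := by
  obtain ⟨P, _, _, d, hP, hd, ⟨e⟩, hQ⟩ := h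
  let _ (i : ℤ) : Module A (P i) := Module.compHom (P i) (algebraMap A B)
  have (i : ℤ) : IsScalarTower A B (P i) := IsScalarTower.of_algebraMap_smul fun _ _ => rfl
  obtain ⟨s, hs⟩ := LinearMap.exists_rightInverse_of_surjective (Algebra.linearMap A B)
    (LinearMap.range_eq_top.mpr hAB)
  refine ⟨P, inferInstance, inferInstance, fun i => (d i).restrictScalars A,
    fun i => ?_, fun i => ?_, ⟨?_⟩, ?_⟩
  · have := hP i
    exact Module.Projective.of_isScalarTower A B (P i)
  · ext a
    exact SetLike.ext_iff.mp (hd i) a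
  · exact e.restrictScalars A
  · intro Q _ _ hp i g hg
    let ι : Q →ₗ[A] B ⊗[A] Q := TensorProduct.mk A B Q 1
    obtain ⟨h, hh⟩ := hQ (B ⊗[A] Q) _ _ inferInstance i
      (LinearMap.extendScalarsOfSurjective hAB (ι ∘ₗ g)) <| LinearMap.ext fun a => by
        have := LinearMap.congr_fun hg a
        simp only [LinearMap.comp_apply, LinearMap.restrictScalars_apply,
          LinearMap.zero_apply] at this
        simp [this]
    refine ⟨TensorProduct.lift (LinearMap.lsmul A Q ∘ₗ s) ∘ₗ h.restrictScalars A,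
      LinearMap.ext fun a => ?_⟩
    have h1 : h (d (i + 1) a) = 1 ⊗ₜ[A] g a := LinearMap.congr_fun hh a
    have h2 : algebraMap A B (s 1) = 1 := LinearMap.congr_fun hs 1
    simp only [LinearMap.comp_apply, LinearMap.restrictScalars_apply, h1, TensorProduct.lift.tmul,
      LinearMap.lsmul_apply]
    rw [← map_smul, ← algebraMap_smul B, h2, one_smul]

end GorensteinProjective

section Periodic

variable {K B : Type u} [Field K] [CommRing B] [Algebra K B] (x : B) (l : B →ₗ[K] B)

/-- The condition on `l` that holds for `B = K[X]/(X³)` with `x` the class of `X` and `l` the map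
reading off the coefficient of `x²`. -/
def IsCubicTrace : Prop :=
  ∀ r, x ^ 2 * l r + x * l (x * r) + l (x ^ 2 * r) = r

variable {x l}

theorem IsCubicTrace.exists_of_projective (h : IsCubicTrace x l) (Q : Type u) [AddCommGroup Q]
    [Module K Q] [Module B Q] [IsScalarTower K B Q] [Module.Projective B Q] :
    ∃ l' : Q →ₗ[K] Q, ∀ q, x ^ 2 • l' q + x • l' (x • q) + l' (x ^ 2 • q) = q := by
  obtain ⟨s, hs⟩ := Module.projective_def.mp (inferInstance : Module.Projective B Q)
  refine ⟨(Finsupp.linearCombination B id).restrictScalars K ∘ₗ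
    Finsupp.mapRange.linearMap l ∘ₗ s.restrictScalars K, fun q => ?_⟩
  have hq : x ^ 2 • Finsupp.mapRange.linearMap l (s q) +
      x • Finsupp.mapRange.linearMap l (x • s q) +
      Finsupp.mapRange.linearMap l (x ^ 2 • s q) = s q := by
    ext i
    simpa using h (s q i)
  refine Eq.trans ?_ ((congrArg (Finsupp.linearCombination B id) hq).trans (hs q))
  simp only [map_add, map_smul, LinearMap.comp_apply, LinearMap.restrictScalars_apply]

theorem IsCubicTrace.rTensor {M : Type u} [AddCommGroup M] [Module K M]
    (h : IsCubicTrace x l) (p : B ⊗[K] M) :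
    x ^ 2 • l.rTensor M p + x • l.rTensor M (x • p) + l.rTensor M (x ^ 2 • p) = p := by
  induction p with
  | zero => simp
  | add p q hp hq =>
    simp only [smul_add, map_add]
    linear_combination (norm := module) hp + hq
  | tmul c m =>
    simp only [TensorProduct.smul_tmul', LinearMap.rTensor_tmul, ← TensorProduct.add_tmul,
      smul_eq_mul, h c]

variable (K x) (M : Type u) [AddCommGroup M] [Module K M] [Module B M] [IsScalarTower K B M]

/-- The endomorphism `1 ⊗ x` of `B ⊗ M`. -/
def rightMul : B ⊗[K] M →ₗ[B] B ⊗[K] M :=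
  (Algebra.lsmul K K M x).baseChange B

/-- The endomorphism `x ⊗ 1 - 1 ⊗ x` of `B ⊗ M`. -/
def koszulDiff : B ⊗[K] M →ₗ[B] B ⊗[K] M :=
  x • LinearMap.id - rightMul K x M

/-- The endomorphism `x² ⊗ 1 + x ⊗ x + 1 ⊗ x²` of `B ⊗ M`. -/
def koszulNorm : B ⊗[K] M →ₗ[B] B ⊗[K] M :=
  x ^ 2 • LinearMap.id + x • rightMul K x M + rightMul K x M ∘ₗ rightMul K x M

variable {M}

@[simp] theorem rightMul_tmul (c : B) (m : M) : rightMul K x M (c ⊗ₜ m) = c ⊗ₜ (x • m) := by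
  simp [rightMul]

theorem koszulDiff_apply (p : B ⊗[K] M) : koszulDiff K x M p = x • p - rightMul K x M p := rfl

theorem koszulNorm_apply (p : B ⊗[K] M) : koszulNorm K x M p =
    x ^ 2 • p + x • rightMul K x M p + rightMul K x M (rightMul K x M p) := rfl

variable {x}

theorem rTensor_rightMul (p : B ⊗[K] M) :
    rightMul K x M (l.rTensor M p) = l.rTensor M (rightMul K x M p) := by
  induction p with
  | zero => simp
  | add p q hp hq => simp [hp, hq]
  | tmul c m => simp

theorem rightMul_rightMul_rightMul (hx : x ^ 3 = 0) (p : B ⊗[K] M) :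
    rightMul K x M (rightMul K x M (rightMul K x M p)) = 0 := by
  induction p with
  | zero => simp
  | add p q hp hq => simp [hp, hq]
  | tmul c m =>
    have : x • x • x • m = 0 := by rw [smul_smul, smul_smul, ← pow_two, ← pow_succ, hx, zero_smul]
    simp [this]

theorem koszulDiff_koszulNorm (hx : x ^ 3 = 0) (p : B ⊗[K] M) :
    koszulDiff K x M (koszulNorm K x M p) = 0 := by
  have h : x ^ 3 • p = 0 := by rw [hx, zero_smul]
  have h' := rightMul_rightMul_rightMul K hx p
  simp only [koszulDiff_apply, koszulNorm_apply, map_add, map_smul]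
  linear_combination (norm := module) h - h'

theorem koszulNorm_koszulDiff (hx : x ^ 3 = 0) (p : B ⊗[K] M) :
    koszulNorm K x M (koszulDiff K x M p) = 0 := by
  have h : x ^ 3 • p = 0 := by rw [hx, zero_smul]
  have h' := rightMul_rightMul_rightMul K hx p
  simp only [koszulDiff_apply, koszulNorm_apply, map_sub, map_smul]
  linear_combination (norm := module) h - h'

variable {K}

theorem IsCubicTrace.range_koszulNorm (h : IsCubicTrace x l) (hx : x ^ 3 = 0) :
    LinearMap.range (koszulNorm K x M) = LinearMap.ker (koszulDiff K x M) := by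
  refine le_antisymm ?_ fun p hp => ⟨l.rTensor M p, ?_⟩
  · rintro _ ⟨p, rfl⟩
    exact koszulDiff_koszulNorm K hx p
  · have hp' : rightMul K x M p = x • p := (sub_eq_zero.mp hp).symm
    refine Eq.trans ?_ (h.rTensor p)
    simp only [koszulNorm_apply, rTensor_rightMul, hp', map_smul, smul_smul, ← pow_two]

theorem IsCubicTrace.range_koszulDiff (h : IsCubicTrace x l) (hx : x ^ 3 = 0) :
    LinearMap.range (koszulDiff K x M) = LinearMap.ker (koszulNorm K x M) := by
  refine le_antisymm ?_ fun p hp => ⟨x • l.rTensor M p + l.rTensor M (x • p) +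
    l.rTensor M (rightMul K x M p), ?_⟩
  · rintro _ ⟨p, rfl⟩
    exact koszulNorm_koszulDiff K hx p
  · have h1 := h.rTensor p
    have h2 : l.rTensor M (x ^ 2 • p + x • rightMul K x M p + rightMul K x M (rightMul K x M p)) =
      0 := by rw [← koszulNorm_apply, LinearMap.mem_ker.mp hp, map_zero]
    simp only [koszulDiff_apply, map_add, map_smul, rTensor_rightMul] at h2 ⊢
    linear_combination (norm := module) h1 - h2

/-- Over a ring generated by `x`, the image of `koszulNorm` is a copy of `M`. -/
theorem IsCubicTrace.nonempty_equiv (h : IsCubicTrace x l) (hx : x ^ 3 = 0)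
    (htop : Algebra.adjoin K {x} = ⊤) :
    Nonempty (M ≃ₗ[B] LinearMap.range (koszulNorm K x M)) := by
  have hmul (c : B) : ∀ m : M, koszulNorm K x M (1 ⊗ₜ (c • m)) = c • koszulNorm K x M (1 ⊗ₜ m) := by
    have hc : c ∈ Algebra.adjoin K {x} := htop ▸ Algebra.mem_top
    induction hc using Algebra.adjoin_induction with
    | mem c hc =>
      intro m
      obtain rfl : c = x := hc
      have := koszulNorm_koszulDiff K hx (1 ⊗ₜ[K] m)
      rw [koszulDiff_apply, map_sub, map_smul, rightMul_tmul] at this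
      exact (sub_eq_zero.mp this).symm
    | algebraMap r =>
      intro m
      rw [algebraMap_smul, algebraMap_smul, TensorProduct.tmul_smul, LinearMap.map_smul_of_tower]
    | add a b _ _ ha hb =>
      intro m
      rw [add_smul, add_smul, TensorProduct.tmul_add, map_add, ha, hb]
    | mul a b _ _ ha hb =>
      intro m
      rw [mul_smul, mul_smul, ha, hb]
  let j : M →ₗ[B] B ⊗[K] M :=
    { toFun m := koszulNorm K x M (1 ⊗ₜ m)
      map_add' m m' := by rw [TensorProduct.tmul_add, map_add]
      map_smul' := hmul }
  have hj : LinearMap.range j = LinearMap.range (koszulNorm K x M) := by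
    refine le_antisymm ?_ ?_
    · rintro _ ⟨m, rfl⟩
      exact ⟨1 ⊗ₜ m, rfl⟩
    · rintro _ ⟨p, rfl⟩
      induction p with
      | zero => simp
      | add p q hp hq =>
        rw [map_add]
        exact add_mem hp hq
      | tmul c m =>
        refine ⟨c • m, (hmul c m).trans ?_⟩
        rw [← map_smul, TensorProduct.smul_tmul', smul_eq_mul, mul_one]
  have hinj : Function.Injective j := by
    refine (injective_iff_map_eq_zero j).mpr fun m hm => ?_
    have h1 := congrArg (fun p => (LinearMap.id (R := K) (M := M)).liftBaseChange B
      (l.rTensor M p)) (show koszulNorm K x M (1 ⊗ₜ m) = 0 from hm)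
    have h2 := congrArg (fun r => r • m) (h 1)
    simp [koszulNorm_apply, TensorProduct.smul_tmul'] at h1
    simp [add_smul, mul_smul] at h2
    linear_combination (norm := module) h1 - h2
  exact ⟨(LinearEquiv.ofInjective j hinj).trans (LinearEquiv.ofEq _ _ hj)⟩

theorem IsCubicTrace.exists_comp_koszulNorm (h : IsCubicTrace x l) {Q : Type u} [AddCommGroup Q]
    [Module K Q] [Module B Q] [IsScalarTower K B Q] [Module.Projective B Q]
    (g : B ⊗[K] M →ₗ[B] Q) (hg : g ∘ₗ koszulDiff K x M = 0) :
    ∃ f : B ⊗[K] M →ₗ[B] Q, f ∘ₗ koszulNorm K x M = g := by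
  obtain ⟨l', hl'⟩ := h.exists_of_projective Q
  have hg' (m : M) : g (1 ⊗ₜ (x • m)) = x • g (1 ⊗ₜ m) := by
    have := LinearMap.congr_fun hg (1 ⊗ₜ m)
    rw [LinearMap.comp_apply, koszulDiff_apply, map_sub, map_smul, rightMul_tmul] at this
    exact (sub_eq_zero.mp this).symm
  refine ⟨(l' ∘ₗ g.restrictScalars K ∘ₗ TensorProduct.mk K B M 1).liftBaseChange B,
    TensorProduct.AlgebraTensorModule.curry_injective
      (LinearMap.ext_ring (LinearMap.ext fun m => ?_))⟩
  have := hl' (g (1 ⊗ₜ m))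
  rw [pow_two, mul_smul x x (g _)] at this
  simpa [koszulNorm_apply, hg', pow_two] using this

theorem IsCubicTrace.exists_comp_koszulDiff (h : IsCubicTrace x l) {Q : Type u} [AddCommGroup Q]
    [Module K Q] [Module B Q] [IsScalarTower K B Q] [Module.Projective B Q]
    (g : B ⊗[K] M →ₗ[B] Q) (hg : g ∘ₗ koszulNorm K x M = 0) :
    ∃ f : B ⊗[K] M →ₗ[B] Q, f ∘ₗ koszulDiff K x M = g := by
  obtain ⟨l', hl'⟩ := h.exists_of_projective Q
  have hg' (m : M) : x ^ 2 • g (1 ⊗ₜ m) + x • g (1 ⊗ₜ (x • m)) + g (1 ⊗ₜ (x • x • m)) = 0 := by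
    have := LinearMap.congr_fun hg (1 ⊗ₜ m)
    simpa only [LinearMap.comp_apply, koszulNorm_apply, map_add, map_smul, rightMul_tmul,
      LinearMap.zero_apply] using this
  let g₀ : M →ₗ[K] Q := g.restrictScalars K ∘ₗ TensorProduct.mk K B M 1
  let X : Q →ₗ[K] Q := Algebra.lsmul K K Q x
  refine ⟨(X ∘ₗ l' ∘ₗ g₀ + l' ∘ₗ X ∘ₗ g₀ + l' ∘ₗ g₀ ∘ₗ Algebra.lsmul K K M x).liftBaseChange B,
    TensorProduct.AlgebraTensorModule.curry_injective
      (LinearMap.ext_ring (LinearMap.ext fun m => ?_))⟩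
  have h1 := hl' (g (1 ⊗ₜ m))
  have h2 := congrArg l' (hg' m)
  simp [koszulDiff_apply, g₀, X] at h1 h2 ⊢
  linear_combination (norm := module) h1 - h2

theorem IsCubicTrace.isGorensteinProjective (h : IsCubicTrace x l) (hx : x ^ 3 = 0)
    (htop : Algebra.adjoin K {x} = ⊤) (M : Type u) [AddCommGroup M] [Module B M] :
    IsGorensteinProjective B M := by
  let _ : Module K M := Module.compHom M (algebraMap K B)
  have : IsScalarTower K B M := IsScalarTower.of_algebraMap_smul fun _ _ => rfl
  refine ⟨fun _ => B ⊗[K] M, fun _ => inferInstance, fun _ => inferInstance,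
    fun i => if Even i then koszulNorm K x M else koszulDiff K x M, fun _ => inferInstance,
    fun i => ?_, ?_, ?_⟩
  · by_cases hi : Even i
    · simp only [hi, Int.even_add_one, if_true, if_false, not_true]
      exact h.range_koszulNorm hx
    · simp only [hi, Int.even_add_one, if_true, if_false, not_false_eq_true]
      exact h.range_koszulDiff hx
  · simpa using h.nonempty_equiv (M := M) hx htop
  · intro Q _ _ _ i g hg
    let _ : Module K Q := Module.compHom Q (algebraMap K B)
    have : IsScalarTower K B Q := IsScalarTower.of_algebraMap_smul fun _ _ => rfl
    by_cases hi : Even i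
    · simp only [hi, Int.even_add_one, if_true, if_false, not_true] at hg ⊢
      exact h.exists_comp_koszulDiff g hg
    · simp only [hi, Int.even_add_one, if_true, if_false, not_false_eq_true] at hg ⊢
      exact h.exists_comp_koszulNorm g hg

end Periodic

section Product

variable {A B : Type u} [CommRing A] [CommRing B]

variable (A B) in
theorem projective_fst : letI := (RingHom.fst A B).toAlgebra; Module.Projective (A × B) A := by
  let _ : Algebra (A × B) A := (RingHom.fst A B).toAlgebra
  exact .of_split (M := A × B)
    { AddMonoidHom.inl A B with map_smul' := fun _ _ => Prod.ext rfl (mul_zero _).symm }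
    (Algebra.linearMap (A × B) A) (LinearMap.ext fun _ => rfl)

variable (A B) in
theorem projective_snd : letI := (RingHom.snd A B).toAlgebra; Module.Projective (A × B) B := by
  let _ : Algebra (A × B) B := (RingHom.snd A B).toAlgebra
  exact .of_split (M := A × B)
    { AddMonoidHom.inr A B with map_smul' := fun _ _ => Prod.ext (mul_zero _).symm rfl }
    (Algebra.linearMap (A × B) B) (LinearMap.ext fun _ => rfl)

/-- A module over `A × B` is Gorenstein projective if its two components are. -/
theorem IsGorensteinProjective.of_prod_ring (M : Type u) [AddCommGroup M] [Module (A × B) M]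
    (hA : letI := (RingHom.fst A B).toAlgebra; IsGorensteinProjective A (A ⊗[A × B] M))
    (hB : letI := (RingHom.snd A B).toAlgebra; IsGorensteinProjective B (B ⊗[A × B] M)) :
    IsGorensteinProjective (A × B) M := by
  let _ : Algebra (A × B) A := (RingHom.fst A B).toAlgebra
  let _ : Algebra (A × B) B := (RingHom.snd A B).toAlgebra
  let e : (A × B) ≃ₗ[A × B] A × B :=
    { AddEquiv.refl (A × B) with map_smul' := fun _ _ => rfl }
  have := projective_fst A B
  have := projective_snd A B
  have hA' : IsGorensteinProjective (A × B) (A ⊗[A × B] M) :=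
    .of_surjective (B := A) Prod.fst_surjective hA
  have hB' : IsGorensteinProjective (A × B) (B ⊗[A × B] M) :=
    .of_surjective (B := B) Prod.snd_surjective hB
  exact (hA'.prod hB').congr <| ((TensorProduct.lid (A × B) M).symm.trans
    ((TensorProduct.congr e (.refl (A × B) M)).trans
      (TensorProduct.prodLeft (A × B) (A × B) A B M))).symm

/-- The base change of a submodule of a projective module to a flat hereditary algebra is
projective. -/
theorem IsHereditaryRing.projective_tensorProduct [Algebra A B] [Module.Flat A B]
    (hB : IsHereditaryRing B) {P : Type u} [AddCommGroup P] [Module A P] [Module.Projective A P]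
    (N : Submodule A P) : Module.Projective B (B ⊗[A] N) := by
  have hinj : Function.Injective (N.subtype.baseChange B) :=
    Module.Flat.lTensor_preserves_injective_linearMap N.subtype N.injective_subtype
  have := hB (B ⊗[A] P) _ _ inferInstance (LinearMap.range (N.subtype.baseChange B))
  exact .of_equiv' (LinearEquiv.ofInjective _ hinj).symm

theorem isGHereditaryRing_prod (hA : ∀ (M : Type u) [AddCommGroup M] [Module A M],
    IsGorensteinProjective A M) (hB : IsHereditaryRing B) : IsGHereditaryRing (A × B) := by
  intro P _ _ _ N
  refine .of_prod_ring N (hA _) ?_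
  let _ : Algebra (A × B) B := (RingHom.snd A B).toAlgebra
  have := projective_snd A B
  have := hB.projective_tensorProduct N
  exact .of_projective _

/-- Over a ring where `x² a = 0` forces `x ∣ e a`, a strongly Gorenstein projective
module killed by `x` is killed by `e`: in a resolution by copies of `P`, the square of `x` kills
`P`, whence `e P ⊆ x P` and `e P = 0`. -/
theorem IsStronglyGorensteinProjective.eq_zero_of_smul_eq_zero {e x : A}
    (hex : ∀ a : A, x ^ 2 * a = 0 → x ∣ e * a) (hxe : x * e = x) {M : Type u} [AddCommGroup M]
    [Module A M] (hM : IsStronglyGorensteinProjective A M) (hxM : ∀ m : M, x • m = 0) (m : M) :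
    e • m = 0 := by
  obtain ⟨P, _, _, f, hP, hf, ⟨i⟩, -⟩ := hM
  have hker (p : P) : x • f p = 0 := by
    have := congrArg (fun z => (i z : P)) (hxM (i.symm ⟨f p, p, rfl⟩))
    simpa using this
  have hsq (p : P) : x ^ 2 • p = 0 := by
    have : x • p ∈ LinearMap.ker f := by rw [LinearMap.mem_ker, map_smul, hker]
    rw [← hf] at this
    obtain ⟨q, hq⟩ := this
    rw [pow_two, mul_smul, ← hq, hker]
  obtain ⟨s, hs⟩ := Module.projective_def.mp hP
  have hdvd (p : P) : ∃ q : P, e • p = x • q := by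
    have hmem : e • p ∈ LinearMap.range (LinearMap.lsmul A P x) := by
      rw [← hs p, Finsupp.linearCombination_apply, Finsupp.smul_sum]
      refine Submodule.sum_mem _ fun j _ => ?_
      obtain ⟨a, ha⟩ := hex (s p j) <| by
        simpa using DFunLike.congr_fun (congrArg s (hsq p)) j
      exact ⟨a • j, by simp [smul_smul, ha, mul_comm]⟩
    obtain ⟨q, hq⟩ := hmem
    exact ⟨q, hq.symm⟩
  have hzero (p : P) : e • p = 0 := by
    obtain ⟨q, hq⟩ := hdvd p
    obtain ⟨r, hr⟩ := hdvd q
    rw [hq, ← hxe, mul_smul, hr, smul_smul, ← pow_two, hsq]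
  apply i.injective
  rw [map_zero, map_smul]
  exact Subtype.ext (hzero _)

theorem not_isSGHereditaryRing_prod {x : A} (hx : x ^ 3 = 0) (hx2 : x ^ 2 ≠ 0)
    (h : ∀ a, x ^ 2 * a = 0 → x ∣ a) : ¬ IsSGHereditaryRing (A × B) := by
  intro hSG
  have hM := hSG (A × B) _ _ inferInstance (Ideal.span {((x ^ 2, 0) : A × B)})
  refine hx2 ?_
  have := hM.eq_zero_of_smul_eq_zero (e := (1, 0)) (x := (x, 0)) ?_ (by simp) ?_
    ⟨(x ^ 2, 0), Ideal.mem_span_singleton_self _⟩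
  · simpa [Subtype.ext_iff] using this
  · rintro ⟨a, b⟩ hab
    obtain ⟨c, hc⟩ := h a (by simpa using hab)
    exact ⟨(c, 0), by simp [hc]⟩
  · rintro ⟨m, hm⟩
    obtain ⟨⟨c, d⟩, rfl⟩ := Ideal.mem_span_singleton.mp hm
    refine Subtype.ext ?_
    simp [← mul_assoc, ← pow_succ', hx]

end Product

section TruncatedPolynomial

open Polynomial

variable (K : Type u) [Field K]

/-- The map on `K[X]/(X³)` reading off the coefficient of `X²`. -/
def coeffTwo : AdjoinRoot (X ^ 3 : K[X]) →ₗ[K] AdjoinRoot (X ^ 3 : K[X]) :=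
  Algebra.linearMap K _ ∘ₗ lcoeff K 2 ∘ₗ AdjoinRoot.modByMonicHom (monic_X_pow 3)

theorem coeffTwo_mk (p : K[X]) :
    coeffTwo K (AdjoinRoot.mk _ p) = AdjoinRoot.mk _ (C (p.coeff 2)) := by
  have h : (p %ₘ X ^ 3).coeff 2 = p.coeff 2 := by
    conv_rhs => rw [← modByMonic_add_div p (X ^ 3 : K[X])]
    rw [coeff_add, coeff_X_pow_mul']
    simp
  simp only [coeffTwo, LinearMap.comp_apply, AdjoinRoot.modByMonicHom_mk, lcoeff_apply, h]
  rfl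

theorem root_X_pow_three : AdjoinRoot.root (X ^ 3 : K[X]) ^ 3 = 0 := by
  rw [← AdjoinRoot.mk_X, ← map_pow, AdjoinRoot.mk_self]

theorem isCubicTrace_coeffTwo :
    IsCubicTrace (AdjoinRoot.root (X ^ 3 : K[X])) (coeffTwo K) := by
  intro r
  obtain ⟨p, rfl⟩ := AdjoinRoot.mk_surjective r
  rw [← AdjoinRoot.mk_X, ← map_pow, ← map_mul, ← map_mul, coeffTwo_mk, coeffTwo_mk, coeffTwo_mk,
    ← map_mul, ← map_mul, ← map_add, ← map_add, AdjoinRoot.mk_eq_mk, X_pow_dvd_iff]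
  intro d hd
  have h1 : (X * p).coeff 2 = p.coeff 1 := coeff_X_mul p 1
  have h2 : (X ^ 2 * p).coeff 2 = p.coeff 0 := coeff_X_pow_mul p 2 0
  rw [h1, h2]
  interval_cases d <;> simp [coeff_X, coeff_C, coeff_X_pow]

theorem root_X_pow_two_ne_zero : AdjoinRoot.root (X ^ 3 : K[X]) ^ 2 ≠ 0 := by
  rw [← AdjoinRoot.mk_X, ← map_pow, Ne, AdjoinRoot.mk_eq_zero, X_pow_dvd_iff]
  intro h
  simpa using h 2 (by norm_num)

end TruncatedPolynomial

/-- Example 2.9(2): `K[X]/(X³) × S` is Gorenstein hereditary but not strongly Gorenstein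
hereditary, for `K` a field and `S` a non-Noetherian hereditary ring. -/
theorem statement_9 (K : Type u) [Field K] (S : Type u) [CommRing S]
    (hS : IsHereditaryRing S) (hS' : ¬ IsNoetherianRing S) :
    IsGHereditaryRing ((Polynomial K ⧸ Ideal.span {(Polynomial.X : Polynomial K) ^ 3}) × S) ∧
    ¬ IsSGHereditaryRing
      ((Polynomial K ⧸ Ideal.span {(Polynomial.X : Polynomial K) ^ 3}) × S) := by
  have h := isCubicTrace_coeffTwo K
  have hx := root_X_pow_three K
  refine ⟨isGHereditaryRing_prod (A := AdjoinRoot (Polynomial.X ^ 3 : Polynomial K))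
    (fun M _ _ => h.isGorensteinProjective hx AdjoinRoot.adjoinRoot_eq_top M) hS,
    not_isSGHereditaryRing_prod (A := AdjoinRoot (Polynomial.X ^ 3 : Polynomial K)) hx
      (root_X_pow_two_ne_zero K) fun a ha => ?_⟩
  have ha' := h a
  rw [ha, map_zero] at ha'
  exact ⟨AdjoinRoot.root (Polynomial.X ^ 3) * coeffTwo K a +
    coeffTwo K (AdjoinRoot.root (Polynomial.X ^ 3) * a), by linear_combination -ha'⟩
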